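/- Let k be a positive integer with k ≡ 2 (mod 4). Then multiplication by ξ gives an isomorphism of ℂ-vector spaces M_{k-1}(SL(2,ℤ), ω̄) ≅ S_{k+2}, i.e. f ↦ f·ξ is a linear bijection. -/

import Mathlib

noncomputable section

open Complex

/-- `τ` lies in the upper half plane. -/
def UHP (τ : ℂ) : Prop := 0 < τ.im

/-- `eC w = exp(2 π i w)`. -/
def eC (w : ℂ) : ℂ := Complex.exp (2 * (Real.pi : ℂ) * Complex.I * w)

/-- Entries of a matrix in `SL(2, ℤ)`, as complex numbers. -/
def Ma (M : Matrix.SpecialLinearGroup (Fin 2) ℤ) : ℂ := ((M.1 0 0 : ℤ) : ℂ)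
def Mb (M : Matrix.SpecialLinearGroup (Fin 2) ℤ) : ℂ := ((M.1 0 1 : ℤ) : ℂ)
def Mc (M : Matrix.SpecialLinearGroup (Fin 2) ℤ) : ℂ := ((M.1 1 0 : ℤ) : ℂ)
def Md (M : Matrix.SpecialLinearGroup (Fin 2) ℤ) : ℂ := ((M.1 1 1 : ℤ) : ℂ)

/-- Hermitian Jacobi form of weight `k` and index `m` for the Hermitian Jacobi group over
`ℤ[i]`.  A form is a function `φ : ℂ → ℂ → ℂ → ℂ`, all conditions being imposed for `τ`
in the upper half plane.  Units `ε ∈ ℤ[i]ˣ = {1, -1, i, -i}`, and the elliptic variables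
`λ = p + q i`, `μ = u + v i` range over `ℤ[i]`.  The Fourier expansion is indexed by
`n ∈ ℕ` and `r = (a + b i)/2 ∈ O_K^♯ = (i/2)ℤ[i]`, supported on `N(r) ≤ n m`,
i.e. `a² + b² ≤ 4 n m`. -/
structure IsHJF (k m : ℕ) (φ : ℂ → ℂ → ℂ → ℂ) : Prop where
  holo : DifferentiableOn ℂ (fun p : ℂ × ℂ × ℂ => φ p.1 p.2.1 p.2.2) {p | UHP p.1}
  transf : ∀ ε : ℂ, ε ∈ ({1, -1, Complex.I, -Complex.I} : Set ℂ) →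
    ∀ M : Matrix.SpecialLinearGroup (Fin 2) ℤ, ∀ τ z₁ z₂ : ℂ, UHP τ →
      φ ((Ma M * τ + Mb M) / (Mc M * τ + Md M))
        (ε * z₁ / (Mc M * τ + Md M))
        ((starRingEnd ℂ) ε * z₂ / (Mc M * τ + Md M))
      = ε ^ k * (Mc M * τ + Md M) ^ k *
          eC ((m : ℂ) * Mc M * z₁ * z₂ / (Mc M * τ + Md M)) * φ τ z₁ z₂
  ellip : ∀ p q u v : ℤ, ∀ τ z₁ z₂ : ℂ, UHP τ →
      φ τ (z₁ + ((p : ℂ) + (q : ℂ) * Complex.I) * τ + ((u : ℂ) + (v : ℂ) * Complex.I))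
          (z₂ + ((p : ℂ) - (q : ℂ) * Complex.I) * τ + ((u : ℂ) - (v : ℂ) * Complex.I))
      = eC (-(m : ℂ) * (((p : ℂ) ^ 2 + (q : ℂ) ^ 2) * τ
          + ((p : ℂ) - (q : ℂ) * Complex.I) * z₁
          + ((p : ℂ) + (q : ℂ) * Complex.I) * z₂)) * φ τ z₁ z₂
  fourier : ∃ c : ℕ → ℤ → ℤ → ℂ,
      (∀ (n : ℕ) (a b : ℤ), 4 * (n : ℤ) * m < a ^ 2 + b ^ 2 → c n a b = 0) ∧
      ∀ τ z₁ z₂ : ℂ, UHP τ →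
        HasSum (fun p : ℕ × ℤ × ℤ => c p.1 p.2.1 p.2.2 *
          eC ((p.1 : ℂ) * τ + (((p.2.1 : ℂ) + (p.2.2 : ℂ) * Complex.I) / 2) * z₁
            + (((p.2.1 : ℂ) - (p.2.2 : ℂ) * Complex.I) / 2) * z₂)) (φ τ z₁ z₂)

/-- Classical Jacobi form of weight `k` and index `m` for `SL(2,ℤ) ⋉ ℤ²`. -/
structure IsJF (k m : ℕ) (φ : ℂ → ℂ → ℂ) : Prop where
  holo : DifferentiableOn ℂ (fun p : ℂ × ℂ => φ p.1 p.2) {p | UHP p.1}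
  transf : ∀ M : Matrix.SpecialLinearGroup (Fin 2) ℤ, ∀ τ z : ℂ, UHP τ →
      φ ((Ma M * τ + Mb M) / (Mc M * τ + Md M)) (z / (Mc M * τ + Md M))
      = (Mc M * τ + Md M) ^ k *
          eC ((m : ℂ) * Mc M * z ^ 2 / (Mc M * τ + Md M)) * φ τ z
  ellip : ∀ p q : ℤ, ∀ τ z : ℂ, UHP τ →
      φ τ (z + (p : ℂ) * τ + (q : ℂ))
      = eC (-(m : ℂ) * ((p : ℂ) ^ 2 * τ + 2 * (p : ℂ) * z)) * φ τ z
  fourier : ∃ c : ℕ → ℤ → ℂ,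
      (∀ (n : ℕ) (r : ℤ), 4 * (n : ℤ) * m < r ^ 2 → c n r = 0) ∧
      ∀ τ z : ℂ, UHP τ →
        HasSum (fun p : ℕ × ℤ => c p.1 p.2 * eC ((p.1 : ℂ) * τ + (p.2 : ℂ) * z)) (φ τ z)

/-- Modular form of weight `k` for `SL(2,ℤ)`. -/
structure IsMF (k : ℕ) (f : ℂ → ℂ) : Prop where
  holo : DifferentiableOn ℂ f {τ | UHP τ}
  transf : ∀ M : Matrix.SpecialLinearGroup (Fin 2) ℤ, ∀ τ : ℂ, UHP τ →
      f ((Ma M * τ + Mb M) / (Mc M * τ + Md M)) = (Mc M * τ + Md M) ^ k * f τ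
  bounded : ∃ A B : ℝ, ∀ τ : ℂ, B ≤ τ.im → ‖f τ‖ ≤ A

/-- Cusp form of weight `k` for `SL(2,ℤ)`. -/
structure IsCF (k : ℕ) (f : ℂ → ℂ) : Prop where
  holo : DifferentiableOn ℂ f {τ | UHP τ}
  transf : ∀ M : Matrix.SpecialLinearGroup (Fin 2) ℤ, ∀ τ : ℂ, UHP τ →
      f ((Ma M * τ + Mb M) / (Mc M * τ + Md M)) = (Mc M * τ + Md M) ^ k * f τ
  decay : ∀ ε : ℝ, 0 < ε → ∃ B : ℝ, ∀ τ : ℂ, B ≤ τ.im → ‖f τ‖ ≤ ε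

/-- `M_w(SL(2,ℤ), ω̄)` for the character `ω` of `SL(2,ℤ)` with `ω(T) = ω(S) = i`:
holomorphic functions on the upper half plane, bounded at infinity, with
`f|_w T = -i f` and `f|_w S = -i f`. -/
structure IsMFOmegaBar (w : ℕ) (f : ℂ → ℂ) : Prop where
  holo : DifferentiableOn ℂ f {τ | UHP τ}
  transT : ∀ τ : ℂ, UHP τ → f (τ + 1) = -Complex.I * f τ
  transS : ∀ τ : ℂ, UHP τ → f (-1 / τ) = -Complex.I * τ ^ w * f τ
  bounded : ∃ A B : ℝ, ∀ τ : ℂ, B ≤ τ.im → ‖f τ‖ ≤ A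

/-- Hermitian theta function `θ^H_{m,s}` of index `m` with characteristic
`s = (a + b i)/2 ∈ O_K^♯`; the sum is over `r = s + m (g₁ + g₂ i) ∈ s + m ℤ[i]`. -/
def thetaH (m : ℕ) (a b : ℤ) (τ z₁ z₂ : ℂ) : ℂ :=
  ∑' g : ℤ × ℤ,
    eC ((((a : ℂ) + 2 * m * g.1) ^ 2 + ((b : ℂ) + 2 * m * g.2) ^ 2) / (4 * m) * τ
      + (((a : ℂ) + 2 * m * g.1) + ((b : ℂ) + 2 * m * g.2) * Complex.I) / 2 * z₁
      + (((a : ℂ) + 2 * m * g.1) - ((b : ℂ) + 2 * m * g.2) * Complex.I) / 2 * z₂)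

/-- Classical theta function `θ_{m,μ}(τ,z) = Σ_{r ≡ μ mod 2m} e(r²τ/(4m) + r z)`. -/
def thetaJ (m : ℕ) (μ : ℤ) (τ z : ℂ) : ℂ :=
  ∑' g : ℤ, eC (((μ : ℂ) + 2 * m * g) ^ 2 / (4 * m) * τ + ((μ : ℂ) + 2 * m * g) * z)

/-- `h` is the family of theta components of `φ` (for index `m`): the `h_{a,b}` depend
only on `(a, b) mod 2m` and `φ = Σ_{s ∈ O_K^♯ / m O_K} h_s θ^H_{m,s}`. -/
def HasThetaDecomp (m : ℕ) (φ : ℂ → ℂ → ℂ → ℂ) (h : ℤ → ℤ → ℂ → ℂ) : Prop :=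
  (∀ (a b : ℤ) (τ : ℂ), h (a + 2 * m) b τ = h a b τ ∧ h a (b + 2 * m) τ = h a b τ) ∧
  ∀ τ z₁ z₂ : ℂ, UHP τ →
    φ τ z₁ z₂ = ∑ a ∈ Finset.range (2 * m), ∑ b ∈ Finset.range (2 * m),
      h (a : ℤ) (b : ℤ) τ * thetaH m (a : ℤ) (b : ℤ) τ z₁ z₂

/-- `ϑ₀(τ) = Σ_{r ∈ ℤ} e(r² τ)`. -/
def theta0C (τ : ℂ) : ℂ := ∑' r : ℤ, eC ((r : ℂ) ^ 2 * τ)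

/-- `ϑ₁(τ) = Σ_{r odd} e(r² τ / 4)`. -/
def theta1C (τ : ℂ) : ℂ := ∑' r : ℤ, eC ((2 * (r : ℂ) + 1) ^ 2 * τ / 4)

/-- `ξ = ϑ₁ ϑ₀' − ϑ₀ ϑ₁'`. -/
def xiC (τ : ℂ) : ℂ := theta1C τ * deriv theta0C τ - theta0C τ * deriv theta1C τ

/-- Taylor coefficient `χ_{α,β}(τ)` of `φ(τ, z₁, z₂)` around `z₁ = z₂ = 0`. -/
def chiHJF (φ : ℂ → ℂ → ℂ → ℂ) (α β : ℕ) (τ : ℂ) : ℂ :=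
  (1 / ((α.factorial : ℂ) * (β.factorial : ℂ))) *
    iteratedDeriv α (fun z₁ => iteratedDeriv β (fun z₂ => φ τ z₁ z₂) 0) 0

/-- `D₀ : J_{k,m} → M_k`, `ψ ↦ ψ(·, 0)`. -/
def D0J (ψ : ℂ → ℂ → ℂ) : ℂ → ℂ := fun τ => ψ τ 0

/-- `D₂ : J_{k,m} → S_{k+2}`, `D₂ψ = (2k/(2πi)²) ψ₂ − (2m/(2πi)) ψ₀'`, where `ψ_ν` are
the Taylor coefficients of `ψ` around `z = 0`. -/
def D2J (k m : ℕ) (ψ : ℂ → ℂ → ℂ) : ℂ → ℂ := fun τ =>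
  (2 * (k : ℂ) / (2 * (Real.pi : ℂ) * Complex.I) ^ 2) *
      ((1 / 2) * iteratedDeriv 2 (fun z => ψ τ z) 0)
    - (2 * (m : ℂ) / (2 * (Real.pi : ℂ) * Complex.I)) * deriv (fun t => ψ t 0) τ

/-- Normalized Eisenstein series `E₄`. -/
def E4C (τ : ℂ) : ℂ :=
  1 + 240 * ∑' n : ℕ, ((ArithmeticFunction.sigma 3) n : ℂ) * eC ((n : ℂ) * τ)

/-- Normalized Eisenstein series `E₆`. -/
def E6C (τ : ℂ) : ℂ :=
  1 - 504 * ∑' n : ℕ, ((ArithmeticFunction.sigma 5) n : ℂ) * eC ((n : ℂ) * τ)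

/-- `f` agrees on the upper half plane with a polynomial in `E₄` and `E₆²` that is
homogeneous of weight `k - v`, i.e. supported on `4a + 12b + v = k`. -/
def IsE4E6sqPoly (v k : ℕ) (f : ℂ → ℂ) : Prop :=
  ∃ lam : ℕ × ℕ → ℂ, ∀ τ : ℂ, UHP τ →
    f τ = ∑ p ∈ (Finset.range (k + 1) ×ˢ Finset.range (k + 1)).filter
        (fun p => 4 * p.1 + 12 * p.2 + v = k),
      lam p * E4C τ ^ p.1 * E6C τ ^ (2 * p.2)

/-- The slash action `φ|_{k,m} M` of `M ∈ SL(2,ℤ)` on functions `ℂ → ℂ → ℂ → ℂ`. -/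
def slashHJF (k m : ℕ) (φ : ℂ → ℂ → ℂ → ℂ) (M : Matrix.SpecialLinearGroup (Fin 2) ℤ)
    (τ z₁ z₂ : ℂ) : ℂ :=
  ((Mc M * τ + Md M) ^ k)⁻¹ *
    eC (-(m : ℂ) * Mc M * z₁ * z₂ / (Mc M * τ + Md M)) *
    φ ((Ma M * τ + Mb M) / (Mc M * τ + Md M)) (z₁ / (Mc M * τ + Md M)) (z₂ / (Mc M * τ + Md M))

/-- Hermitian Jacobi form of weight `k` and index `m` for the congruence subgroup `Γ₀(N)`,
with at each cusp a Fourier expansion supported on `(n, r) ∈ ℚ_{≥0} × O_K^♯`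
with `N(r) ≤ n m`. -/
structure IsHJFLevel (k m N : ℕ) (φ : ℂ → ℂ → ℂ → ℂ) : Prop where
  holo : DifferentiableOn ℂ (fun p : ℂ × ℂ × ℂ => φ p.1 p.2.1 p.2.2) {p | UHP p.1}
  transf : ∀ ε : ℂ, ε ∈ ({1, -1, Complex.I, -Complex.I} : Set ℂ) →
    ∀ M : Matrix.SpecialLinearGroup (Fin 2) ℤ, (N : ℤ) ∣ M.1 1 0 →
    ∀ τ z₁ z₂ : ℂ, UHP τ →
      φ ((Ma M * τ + Mb M) / (Mc M * τ + Md M))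
        (ε * z₁ / (Mc M * τ + Md M))
        ((starRingEnd ℂ) ε * z₂ / (Mc M * τ + Md M))
      = ε ^ k * (Mc M * τ + Md M) ^ k *
          eC ((m : ℂ) * Mc M * z₁ * z₂ / (Mc M * τ + Md M)) * φ τ z₁ z₂
  ellip : ∀ p q u v : ℤ, ∀ τ z₁ z₂ : ℂ, UHP τ →
      φ τ (z₁ + ((p : ℂ) + (q : ℂ) * Complex.I) * τ + ((u : ℂ) + (v : ℂ) * Complex.I))
          (z₂ + ((p : ℂ) - (q : ℂ) * Complex.I) * τ + ((u : ℂ) - (v : ℂ) * Complex.I))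
      = eC (-(m : ℂ) * (((p : ℂ) ^ 2 + (q : ℂ) ^ 2) * τ
          + ((p : ℂ) - (q : ℂ) * Complex.I) * z₁
          + ((p : ℂ) + (q : ℂ) * Complex.I) * z₂)) * φ τ z₁ z₂
  cusp : ∀ M : Matrix.SpecialLinearGroup (Fin 2) ℤ,
      ∃ c : ℚ → ℤ → ℤ → ℂ,
        (∀ (n : ℚ) (a b : ℤ),
          ¬ (0 ≤ n ∧ ((a : ℚ) ^ 2 + (b : ℚ) ^ 2) ≤ 4 * n * m) → c n a b = 0) ∧
        ∀ τ z₁ z₂ : ℂ, UHP τ →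
          HasSum (fun p : ℚ × ℤ × ℤ => c p.1 p.2.1 p.2.2 *
            eC ((p.1 : ℂ) * τ + (((p.2.1 : ℂ) + (p.2.2 : ℂ) * Complex.I) / 2) * z₁
              + (((p.2.1 : ℂ) - (p.2.2 : ℂ) * Complex.I) / 2) * z₂))
            (slashHJF k m φ M τ z₁ z₂)

/-- Theta constant `x`. -/
def thConstX (τ : ℂ) : ℂ := ∑' n : ℤ, eC ((n : ℂ) ^ 2 * τ / 2)

/-- Theta constant `y`. -/
def thConstY (τ : ℂ) : ℂ := ∑' n : ℤ, (-1 : ℂ) ^ n * eC ((n : ℂ) ^ 2 * τ / 2)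

/-- Theta constant `z`. -/
def thConstZ (τ : ℂ) : ℂ := ∑' n : ℤ, eC (((n : ℂ) + 1 / 2) ^ 2 * τ / 2)


section helpers
open scoped MatrixGroups ModularForm UpperHalfPlane Manifold
open Filter
open UpperHalfPlane hiding I

lemma aux_coe_smul (M : SL(2, ℤ)) (τ : ℍ) :
    ((M • τ : ℍ) : ℂ) = (Ma M * τ + Mb M) / (Mc M * τ + Md M) := by
  rw [UpperHalfPlane.specialLinearGroup_apply]
  simp [Ma, Mb, Mc, Md]

lemma aux_slash_iff (k : ℕ) (g : ℂ → ℂ) (M : SL(2, ℤ)) (τ : ℍ) :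
    ((fun z : ℍ => g z) ∣[(k : ℤ)] M) τ = g τ ↔
      g ((Ma M * τ + Mb M) / (Mc M * τ + Md M)) = (Mc M * τ + Md M) ^ k * g τ := by
  rw [ModularForm.slash_action_eq'_iff (k : ℤ) (fun z : ℍ => g z) M τ, aux_coe_smul, zpow_natCast]
  rfl

lemma aux_transf (k : ℕ) (g : ℂ → ℂ) (hT : ∀ τ, UHP τ → g (τ + 1) = g τ)
    (hS : ∀ τ, UHP τ → g (-1 / τ) = τ ^ k * g τ) (M : SL(2, ℤ)) (τ : ℂ) (hτ : UHP τ) :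
    g ((Ma M * τ + Mb M) / (Mc M * τ + Md M)) = (Mc M * τ + Md M) ^ k * g τ := by
  refine (aux_slash_iff k g M ⟨τ, hτ⟩).1 (congrFun (SlashInvariantForm.slash_action_generators_SL2Z ?_ ?_ M) _)
  · ext z
    rw [aux_slash_iff]
    simpa [Ma, Mb, Mc, Md, ModularGroup.S] using hS z z.2
  · ext z
    rw [aux_slash_iff]
    simpa [Ma, Mb, Mc, Md, ModularGroup.T] using hT z z.2

lemma aux_cusp (k : ℕ) (g : ℂ → ℂ) (hg : IsCF k g) :
    ∃ F : CuspForm 𝒮ℒ (k : ℤ), ∀ τ : ℍ, F τ = g τ := by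
  have hsl : ∀ γ : SL(2, ℤ), ((fun z : ℍ => g z) ∣[(k : ℤ)] γ) = fun z : ℍ => g z := by
    intro γ
    ext z
    rw [aux_slash_iff]
    exact hg.transf γ z z.2
  refine ⟨{ toFun := fun z : ℍ => g z, slash_action_eq' := ?_, holo' := ?_, zero_at_cusps' := ?_ }, fun τ => rfl⟩
  · rintro A ⟨γ, rfl⟩
    exact hsl γ
  · rw [UpperHalfPlane.mdifferentiable_iff]
    refine hg.holo.congr fun z hz ↦ ?_
    simp [ofComplex_apply_of_im_pos hz]
  · intro c hc
    rw [Subgroup.IsArithmetic.isCusp_iff_isCusp_SL2Z] at hc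
    rw [OnePoint.isZeroAt_iff_forall_SL2Z hc]
    intro γ _
    have := hsl γ
    rw [this, UpperHalfPlane.isZeroAtImInfty_iff]
    intro ε hε
    obtain ⟨B, hB⟩ := hg.decay ε hε
    exact ⟨B, fun z hz => hB z hz⟩

/-- `A(τ) = ϑ₀`, in terms of Mathlib's theta. -/
lemma theta0C_eq (τ : ℂ) : theta0C τ = jacobiTheta (2 * τ) := by
  unfold theta0C jacobiTheta eC
  congr 1; ext r; congr 1; ring

lemma aux_summ (τ : ℂ) (hτ : UHP τ) :
    Summable (fun r : ℤ => Complex.exp (Real.pi * I * (r : ℂ) ^ 2 * (τ / 2))) := by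
  have h2 : 0 < (τ / 2).im := by
    have : 0 < τ.im := hτ
    simp; exact this
  have := (hasSum_jacobiTheta₂_term 0 h2).summable
  refine this.congr fun r => ?_
  simp [jacobiTheta₂_term]

lemma aux_add (τ : ℂ) (hτ : UHP τ) : theta0C τ + theta1C τ = jacobiTheta (τ / 2) := by
  have hs := aux_summ τ hτ
  have he : Function.Injective (fun r : ℤ => 2 * r) := fun a b h => by simpa using h
  have ho : Function.Injective (fun r : ℤ => 2 * r + 1) := fun a b h => by simpa using h
  have hc : IsCompl (Set.range (fun r : ℤ => 2 * r)) (Set.range (fun r : ℤ => 2 * r + 1)) := by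
    simpa using Int.isCompl_even_odd
  have h0 : HasSum ((fun r : ℤ => Complex.exp (Real.pi * I * (r : ℂ) ^ 2 * (τ / 2))) ∘ fun r : ℤ => 2 * r)
      (theta0C τ) := by
    refine (hs.comp_injective he).hasSum_iff.2 ?_
    unfold theta0C eC
    refine tsum_congr fun r => ?_
    simp only [Function.comp]; push_cast; congr 1; ring
  have h1 : HasSum ((fun r : ℤ => Complex.exp (Real.pi * I * (r : ℂ) ^ 2 * (τ / 2))) ∘ fun r : ℤ => 2 * r + 1)
      (theta1C τ) := by
    refine (hs.comp_injective ho).hasSum_iff.2 ?_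
    unfold theta1C eC
    refine tsum_congr fun r => ?_
    simp only [Function.comp]; push_cast; congr 1; ring
  have := HasSum.add_isCompl (f := fun r : ℤ => Complex.exp (Real.pi * I * (r : ℂ) ^ 2 * (τ / 2)))
    hc (he.hasSum_range_iff.2 h0) (ho.hasSum_range_iff.2 h1)
  exact this.tsum_eq.symm

lemma theta1C_eq (τ : ℂ) (hτ : UHP τ) : theta1C τ = jacobiTheta (τ / 2) - jacobiTheta (2 * τ) := by
  rw [← aux_add τ hτ, theta0C_eq]; ring

lemma theta0C_T (τ : ℂ) : theta0C (τ + 1) = theta0C τ := by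
  rw [theta0C_eq, theta0C_eq, ← jacobiTheta_two_add (2 * τ)]; congr 1; ring

lemma theta1C_T (τ : ℂ) : theta1C (τ + 1) = I * theta1C τ := by
  unfold theta1C
  rw [← tsum_mul_left]
  congr 1; ext r
  unfold eC
  have hI : I = Complex.exp (Real.pi / 2 * I + ((r ^ 2 + r : ℤ) : ℂ) * (2 * Real.pi * I)) := by
    rw [Complex.exp_add, Complex.exp_int_mul_two_pi_mul_I, Complex.exp_pi_div_two_mul_I, mul_one]
  conv_rhs => enter [1]; rw [hI]
  rw [← Complex.exp_add]
  congr 1; push_cast; ring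

lemma isOpen_UHP : IsOpen {τ | UHP τ} := isOpen_lt continuous_const Complex.continuous_im

lemma UHP.ne {τ : ℂ} (h : UHP τ) : τ ≠ 0 := by
  rintro rfl; simp [UHP] at h

lemma UHP.S {τ : ℂ} (h : UHP τ) : UHP (-1 / τ) := by
  have h' : 0 < τ.im := h
  have := Complex.normSq_pos.2 h.ne
  simp only [UHP, neg_div, one_div, Complex.neg_im, Complex.inv_im]
  rw [neg_neg]; positivity

lemma UHP.T {τ : ℂ} (h : UHP τ) : UHP (τ + 1) := by simpa [UHP] using h

/-- `A` and `B`. -/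
def tA (τ : ℂ) : ℂ := jacobiTheta (2 * τ)
def tB (τ : ℂ) : ℂ := jacobiTheta (τ / 2)

lemma UHP.two {τ : ℂ} (h : UHP τ) : 0 < (2 * τ).im := by
  have : 0 < τ.im := h
  simp; exact this

lemma UHP.half {τ : ℂ} (h : UHP τ) : 0 < (τ / 2).im := by
  have : 0 < τ.im := h
  simp; exact this

lemma tA_diff {τ : ℂ} (h : UHP τ) : DifferentiableAt ℂ tA τ :=
  (differentiableAt_jacobiTheta h.two).comp τ (by fun_prop)

lemma tB_diff {τ : ℂ} (h : UHP τ) : DifferentiableAt ℂ tB τ :=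
  DifferentiableAt.comp (f := fun τ : ℂ => τ / 2) τ (differentiableAt_jacobiTheta h.half) (by fun_prop)

lemma theta0C_eq_tA : theta0C = tA := funext theta0C_eq

lemma deriv_theta1C {τ : ℂ} (h : UHP τ) : deriv theta1C τ = deriv tB τ - deriv tA τ := by
  rw [← deriv_sub (tB_diff h) (tA_diff h)]
  apply Filter.EventuallyEq.deriv_eq
  filter_upwards [isOpen_UHP.mem_nhds h] with z hz
  exact theta1C_eq z hz

lemma xi_eq {τ : ℂ} (h : UHP τ) : xiC τ = tB τ * deriv tA τ - tA τ * deriv tB τ := by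
  unfold xiC
  rw [deriv_theta1C h, theta1C_eq τ h, theta0C_eq_tA]
  change (tB τ - tA τ) * _ - _ = _
  ring

lemma xi_diff : DifferentiableOn ℂ xiC {τ | UHP τ} := by
  have hA : DifferentiableOn ℂ tA {τ | UHP τ} := fun z hz => (tA_diff hz).differentiableWithinAt
  have hB : DifferentiableOn ℂ tB {τ | UHP τ} := fun z hz => (tB_diff hz).differentiableWithinAt
  exact ((hB.mul (hA.deriv isOpen_UHP)).sub (hA.mul (hB.deriv isOpen_UHP))).congr fun z hz => xi_eq hz

lemma xi_T {τ : ℂ} (h : UHP τ) : xiC (τ + 1) = I * xiC τ := by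
  unfold xiC
  rw [theta0C_T, theta1C_T, ← deriv_comp_add_const, ← deriv_comp_add_const]
  simp only [theta0C_T, theta1C_T, deriv_const_mul_field]
  ring

lemma jt_S {τ : ℂ} (h : 0 < τ.im) : jacobiTheta (-1 / τ) = (-I * τ) ^ (1 / 2 : ℂ) * jacobiTheta τ := by
  have := jacobiTheta_S_smul ⟨τ, h⟩
  rw [UpperHalfPlane.modular_S_smul] at this
  simpa [neg_div, inv_neg] using this

def sqh (τ : ℂ) : ℂ := (-I * (τ / 2)) ^ (1 / 2 : ℂ)

lemma sqh_sqh (τ : ℂ) : sqh τ * sqh τ = -I * (τ / 2) := by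
  unfold sqh
  rw [← pow_two, ← Complex.cpow_nat_mul]; simp

lemma sqh_diff {τ : ℂ} (h : UHP τ) : DifferentiableAt ℂ sqh τ := by
  have : 0 < τ.im := h
  unfold sqh
  apply DifferentiableAt.cpow_const (by fun_prop)
  left
  simp; linarith

lemma sqh_four {τ : ℂ} (h : UHP τ) : (-I * (2 * τ)) ^ (1 / 2 : ℂ) = 2 * sqh τ := by
  unfold sqh
  have : -I * (2 * τ) = ((4 : ℝ) : ℂ) * (-I * (τ / 2)) := by push_cast; ring
  have h0 : -I * (τ / 2) ≠ 0 := by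
    have := h.ne
    simp [this]
  have h4 : ((4 : ℝ) : ℂ) ≠ 0 := by norm_num
  rw [this, Complex.cpow_def_of_ne_zero (mul_ne_zero h4 h0), Complex.cpow_def_of_ne_zero h0,
    Complex.log_ofReal_mul (by norm_num) h0, add_mul, Complex.exp_add]
  congr 1
  have : Real.log 4 = 2 * Real.log 2 := by
    rw [show (4 : ℝ) = 2 ^ 2 by norm_num, Real.log_pow]; norm_num
  rw [this]
  have h2 : (((2 * Real.log 2 : ℝ) : ℂ)) * (1 / 2) = ((Real.log 2 : ℝ) : ℂ) := by push_cast; ring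
  rw [h2, ← Complex.ofReal_exp, Real.exp_log (by norm_num)]; norm_num

lemma tA_S {τ : ℂ} (h : UHP τ) : tA (-1 / τ) = sqh τ * tB τ := by
  unfold tA tB sqh
  rw [← jt_S h.half]; congr 1; field_simp

lemma tB_S {τ : ℂ} (h : UHP τ) : tB (-1 / τ) = 2 * sqh τ * tA τ := by
  unfold tA tB
  rw [← sqh_four h, ← jt_S h.two]; congr 1; field_simp

lemma deriv_S {F G : ℂ → ℂ} {τ : ℂ} (h : UHP τ) (hF : ∀ z, UHP z → DifferentiableAt ℂ F z)
    (hFG : ∀ z, UHP z → F (-1 / z) = G z) : deriv F (-1 / τ) = τ ^ 2 * deriv G τ := by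
  have h1 : HasDerivAt (fun z : ℂ => -1 / z) (1 / τ ^ 2) τ := by
    have := (hasDerivAt_inv h.ne).neg
    rw [show (fun z : ℂ => -1 / z) = -fun y : ℂ => y⁻¹ by
      funext z; simp only [Pi.neg_apply, neg_div, one_div], one_div, ← neg_neg (τ ^ 2)⁻¹]
    exact this
  have h2 := (hF _ h.S).hasDerivAt.comp τ h1
  have h3 : deriv G τ = deriv (F ∘ fun z : ℂ => -1 / z) τ := by
    apply Filter.EventuallyEq.deriv_eq
    filter_upwards [isOpen_UHP.mem_nhds h] with z hz
    exact (hFG z hz).symm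
  rw [h3, h2.deriv]
  have := h.ne
  field_simp

lemma xi_S {τ : ℂ} (h : UHP τ) : xiC (-1 / τ) = I * τ ^ 3 * xiC τ := by
  rw [xi_eq h, xi_eq h.S, tA_S h, tB_S h,
    deriv_S (G := fun z => sqh z * tB z) h (fun z hz => tA_diff hz) (fun z hz => tA_S hz),
    deriv_S (G := fun z => 2 * sqh z * tA z) h (fun z hz => tB_diff hz) (fun z hz => tB_S hz)]
  rw [deriv_fun_mul (sqh_diff h) (tB_diff h), deriv_fun_mul ((sqh_diff h).const_mul 2) (tA_diff h),
    deriv_const_mul_field]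
  linear_combination (2 * τ ^ 2 * (tA τ * deriv tB τ - tB τ * deriv tA τ)) * sqh_sqh τ

/-- Decay of theta. -/
lemma jt_lim (ε : ℝ) (hε : 0 < ε) : ∃ B : ℝ, 0 < B ∧ ∀ τ : ℂ, B ≤ τ.im → ‖jacobiTheta τ - 1‖ ≤ ε := by
  have h1 : Tendsto (fun y : ℝ => Real.exp (-Real.pi * y)) atTop (nhds 0) :=
    Real.tendsto_exp_atBot.comp (tendsto_id.const_mul_atTop_of_neg (neg_lt_zero.2 Real.pi_pos))
  have h2 : Tendsto (fun y : ℝ => 2 / (1 - Real.exp (-Real.pi * y)) * Real.exp (-Real.pi * y)) atTop (nhds 0) := by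
    have := ((tendsto_const_nhds (x := (2:ℝ))).div ((tendsto_const_nhds (x := (1:ℝ))).sub h1) (by norm_num)).mul h1
    simpa using this
  obtain ⟨B, hB⟩ := eventually_atTop.1 (h2.eventually (gt_mem_nhds hε))
  refine ⟨max B 1, by positivity, fun τ hτ => ?_⟩
  have := le_trans (le_max_right B 1) hτ
  exact (norm_jacobiTheta_sub_one_le (by linarith)).trans (hB _ (le_trans (le_max_left B 1) hτ)).le

/-- Both `A` and `B` tend to one, and their derivatives tend to zero. -/
lemma tAB_lim (ε : ℝ) (hε : 0 < ε) : ∃ B : ℝ, 0 < B ∧ ∀ τ : ℂ, B ≤ τ.im →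
    ‖tA τ - 1‖ ≤ ε ∧ ‖tB τ - 1‖ ≤ ε ∧ ‖deriv tA τ‖ ≤ ε ∧ ‖deriv tB τ‖ ≤ ε := by
  obtain ⟨B, hB0, hB⟩ := jt_lim ε hε
  have hA1 : ∀ τ : ℂ, 2 * B ≤ τ.im → ‖tA τ - 1‖ ≤ ε := fun τ hτ => hB _ (by simp; linarith)
  have hB1 : ∀ τ : ℂ, 2 * B ≤ τ.im → ‖tB τ - 1‖ ≤ ε := fun τ hτ => hB _ (by simp; linarith)
  have key : ∀ F : ℂ → ℂ, (∀ z, UHP z → DifferentiableAt ℂ F z) →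
      (∀ τ : ℂ, 2 * B ≤ τ.im → ‖F τ - 1‖ ≤ ε) → ∀ τ : ℂ, 2 * B + 1 ≤ τ.im → ‖deriv F τ‖ ≤ ε := by
    intro F hF hF1 τ hτ
    have him : ∀ z ∈ Metric.closedBall τ 1, 2 * B ≤ z.im := by
      intro z hz
      have h1 : |(z - τ).im| ≤ 1 := (Complex.abs_im_le_norm _).trans (by simpa [dist_eq_norm] using hz)
      have := (abs_le.1 h1).1
      simp at this
      linarith
    have := Complex.norm_deriv_le_of_forall_mem_sphere_norm_le (f := fun z => F z - 1) (c := τ)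
      (R := 1) (C := ε) one_pos ?_ (fun z hz => hF1 z (him z (Metric.sphere_subset_closedBall hz)))
    · simpa using this
    · refine DifferentiableOn.diffContOnCl fun z hz => ?_
      rw [closure_ball _ one_ne_zero] at hz
      have : UHP z := by have := him z hz; unfold UHP; linarith
      exact ((hF z this).sub_const 1).differentiableWithinAt
  exact ⟨2 * B + 1, by linarith, fun τ hτ => ⟨hA1 τ (by linarith), hB1 τ (by linarith),
    key tA (fun z hz => tA_diff hz) hA1 τ hτ, key tB (fun z hz => tB_diff hz) hB1 τ hτ⟩⟩

lemma xi_lim (ε : ℝ) (hε : 0 < ε) : ∃ B : ℝ, 0 < B ∧ ∀ τ : ℂ, B ≤ τ.im → ‖xiC τ‖ ≤ ε := by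
  obtain ⟨B, hB0, hB⟩ := tAB_lim (min 1 (ε / 4)) (by positivity)
  refine ⟨B, hB0, fun τ hτ => ?_⟩
  obtain ⟨h1, h2, h3, h4⟩ := hB τ hτ
  rw [xi_eq (show UHP τ from lt_of_lt_of_le hB0 hτ)]
  have hA : ‖tA τ‖ ≤ 2 := by
    have := norm_add_le (tA τ - 1) 1
    have := min_le_left 1 (ε / 4)
    simp at *; linarith
  have hB : ‖tB τ‖ ≤ 2 := by
    have := norm_add_le (tB τ - 1) 1
    have := min_le_left 1 (ε / 4)
    simp at *; linarith
  have := min_le_right 1 (ε / 4)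
  calc _ ≤ ‖tB τ‖ * ‖deriv tA τ‖ + ‖tA τ‖ * ‖deriv tB τ‖ := by
        rw [← norm_mul, ← norm_mul]; exact norm_sub_le _ _
    _ ≤ 2 * (ε / 4) + 2 * (ε / 4) := by gcongr <;> linarith
    _ = ε := by ring

lemma theta1_ne {t : ℝ} (ht : 0 < t) : theta1C (t * I) ≠ 0 := by
  have hU : UHP (t * I) := by simpa [UHP] using ht
  have ho : Function.Injective (fun r : ℤ => 2 * r + 1) := fun a b h => by simpa using h
  have hs := (aux_summ _ hU).comp_injective ho
  have he : ∀ r : ℤ, Complex.exp (Real.pi * I * ((2 * r + 1 : ℤ) : ℂ) ^ 2 * (t * I / 2)) =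
      ((Real.exp (-Real.pi * (2 * r + 1) ^ 2 * t / 2) : ℝ) : ℂ) := by
    intro r
    push_cast
    congr 1
    linear_combination (Real.pi * (2 * r + 1) ^ 2 * t / 2 : ℂ) * I_sq
  have h1 : theta1C (t * I) = ((∑' r : ℤ, Real.exp (-Real.pi * (2 * r + 1) ^ 2 * t / 2) : ℝ) : ℂ) := by
    rw [Complex.ofReal_tsum]
    unfold theta1C eC
    congr 1; ext r
    rw [← he]; congr 1; push_cast; ring
  have hs' : Summable fun r : ℤ => Real.exp (-Real.pi * (2 * r + 1) ^ 2 * t / 2) := by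
    rw [← Complex.summable_ofReal]
    exact hs.congr fun r => (he r)
  rw [h1]
  exact_mod_cast (hs'.tsum_pos (fun _ => (Real.exp_pos _).le) 0 (Real.exp_pos _)).ne'

lemma xi_not_zero : ∃ τ, UHP τ ∧ xiC τ ≠ 0 := by
  by_contra! hcon
  obtain ⟨B, hB0, hB⟩ := tAB_lim (1 / 2) (by norm_num)
  have hU : ∀ z ∈ {z : ℂ | B < z.im}, UHP z := fun z hz => hB0.trans hz
  have hA0 : ∀ z ∈ {z : ℂ | B < z.im}, theta0C z ≠ 0 := by
    intro z hz h0
    have := (hB z (le_of_lt hz)).1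
    rw [← theta0C_eq_tA, h0] at this
    norm_num at this
  have hd1 : ∀ z, UHP z → DifferentiableAt ℂ theta1C z := by
    intro z hz
    refine ((tB_diff hz).sub (tA_diff hz)).congr_of_eventuallyEq ?_
    filter_upwards [isOpen_UHP.mem_nhds hz] with w hw
    exact theta1C_eq w hw
  have hd0 : ∀ z, UHP z → DifferentiableAt ℂ theta0C z := by
    intro z hz; rw [theta0C_eq_tA]; exact tA_diff hz
  have ho : IsOpen {z : ℂ | B < z.im} := isOpen_lt continuous_const Complex.continuous_im
  have hc : IsPreconnected {z : ℂ | B < z.im} := (convex_halfSpace_im_gt B).isPreconnected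
  have hconst {x y : ℂ} := ho.is_const_of_deriv_eq_zero hc (x := x) (y := y) (f := fun z => theta1C z / theta0C z)
    (fun z hz => ((hd1 z (hU z hz)).div (hd0 z (hU z hz)) (hA0 z hz)).differentiableWithinAt)
    (fun z hz => by
      rw [deriv_fun_div (hd1 z (hU z hz)) (hd0 z (hU z hz)) (hA0 z hz)]
      have := hcon z (hU z hz)
      unfold xiC at this
      simp only [Pi.zero_apply]
      rw [div_eq_zero_iff]; left
      linear_combination -this)
  have hx : ((B + 1 : ℝ) * I) ∈ {z : ℂ | B < z.im} := by simp
  have hy : ((B + 1 : ℝ) * I + 1) ∈ {z : ℂ | B < z.im} := by simp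
  have h := hconst hx hy
  simp only [theta1C_T, theta0C_T] at h
  have hne := theta1_ne (t := B + 1) (by linarith)
  have h0 := hA0 _ hx
  field_simp at h
  have := congrArg Complex.re h
  simp at this

lemma xi_pow_four : ∃ c : ℂ, c ≠ 0 ∧ ∀ τ : ℍ, xiC τ ^ 4 = c * ModularForm.discriminant τ := by
  have hcf : IsCF 12 (fun τ => xiC τ ^ 4) := by
    refine ⟨xi_diff.pow 4, aux_transf 12 (fun τ => xiC τ ^ 4) ?_ ?_, ?_⟩
    · intro τ h
      simp only [xi_T h, mul_pow, I_pow_four, one_mul]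
    · intro τ h
      simp only [xi_S h, mul_pow, I_pow_four, one_mul]; ring
    · intro ε hε
      obtain ⟨B, hB0, hB⟩ := xi_lim (min 1 ε) (by positivity)
      refine ⟨B, fun τ hτ => ?_⟩
      have h := hB τ hτ
      have h1 := h.trans (min_le_left _ _)
      have h2 := h.trans (min_le_right _ _)
      rw [norm_pow]
      calc ‖xiC τ‖ ^ 4 ≤ ‖xiC τ‖ := pow_le_of_le_one (norm_nonneg _) h1 (by norm_num)
        _ ≤ ε := h2
  obtain ⟨F, hF⟩ := aux_cusp 12 _ hcf
  obtain ⟨c, hc⟩ := CuspForm.exists_smul_discriminant_of_weight_eq_twelve F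
  have h : ∀ τ : ℍ, xiC τ ^ 4 = c * ModularForm.discriminant τ := by
    intro τ
    rw [← hF τ, ← hc]; rfl
  refine ⟨c, ?_, h⟩
  rintro rfl
  obtain ⟨τ, hτ, hne⟩ := xi_not_zero
  have := h ⟨τ, hτ⟩
  simp at this
  exact hne this

lemma xi_ne {τ : ℂ} (h : UHP τ) : xiC τ ≠ 0 := by
  obtain ⟨c, hc, hx⟩ := xi_pow_four
  have := hx ⟨τ, h⟩
  intro h0
  change xiC τ ^ 4 = _ at this
  rw [h0] at this
  exact mul_ne_zero hc (ModularForm.discriminant_ne_zero _) (by rw [← this]; norm_num)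

lemma div_bounded (k : ℕ) (g : ℂ → ℂ) (hg : IsCF k g) :
    ∃ A B : ℝ, ∀ τ : ℂ, B ≤ τ.im → ‖g τ / xiC τ‖ ≤ A := by
  obtain ⟨c, hc, hx⟩ := xi_pow_four
  obtain ⟨F, hF⟩ := aux_cusp k g hg
  obtain ⟨C, hC⟩ := (CuspForm.exp_decay_isBigO_discriminant F).bound
  obtain ⟨B1, hB1⟩ := (UpperHalfPlane.atImInfty_mem _).1 hC
  obtain ⟨B2, hB2⟩ := hg.decay 1 one_pos
  refine ⟨max 1 (C / ‖c‖), max 1 (max B1 B2), fun τ hτ => ?_⟩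
  have h1 : 1 ≤ τ.im := (le_max_left _ _).trans hτ
  have h2 : B1 ≤ τ.im := (le_max_left _ _).trans ((le_max_right _ _).trans hτ)
  have h3 : B2 ≤ τ.im := (le_max_right _ _).trans ((le_max_right _ _).trans hτ)
  have hU : UHP τ := by unfold UHP; linarith
  have hb := hB1 ⟨τ, hU⟩ h2
  simp only [Set.mem_ofPred_eq, hF] at hb
  change ‖g τ‖ ≤ _ at hb
  have hx' := hx ⟨τ, hU⟩
  change xiC τ ^ 4 = _ at hx'
  have hD := norm_pos_iff.2 (ModularForm.discriminant_ne_zero ⟨τ, hU⟩)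
  have hcp := norm_pos_iff.2 hc
  have h4 : ‖g τ / xiC τ‖ ^ 4 ≤ C / ‖c‖ := by
    rw [← norm_pow, div_pow, hx', norm_div, norm_mul, norm_pow,
      div_le_div_iff₀ (by positivity) hcp]
    have : ‖g τ‖ ^ 4 ≤ ‖g τ‖ := pow_le_of_le_one (norm_nonneg _) (hB2 τ h3) (by norm_num)
    calc _ ≤ (C * ‖ModularForm.discriminant ⟨τ, hU⟩‖) * ‖c‖ := by
          gcongr; exact this.trans hb
      _ = _ := by ring
  by_contra! hlt
  have ha := lt_of_le_of_lt (le_max_left _ _) hlt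
  have hb' := lt_of_le_of_lt (le_max_right _ _) hlt
  have : ‖g τ / xiC τ‖ ≤ ‖g τ / xiC τ‖ ^ 4 := le_self_pow₀ ha.le (by norm_num)
  linarith

end helpers

/-- for `k ≡ 2 (mod 4)`, multiplication by `ξ = ϑ₁ϑ₀' − ϑ₀ϑ₁'` is a linear
bijection `M_{k-1}(SL(2,ℤ), ω̄) ≅ S_{k+2}`. -/
theorem stmt4 (k : ℕ) (hk : 0 < k) (hk4 : k % 4 = 2) :
    (∀ f : ℂ → ℂ, IsMFOmegaBar (k - 1) f → IsCF (k + 2) (fun τ => f τ * xiC τ)) ∧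
    (∀ f f' : ℂ → ℂ, IsMFOmegaBar (k - 1) f → IsMFOmegaBar (k - 1) f' →
      (∀ τ : ℂ, UHP τ → f τ * xiC τ = f' τ * xiC τ) →
      ∀ τ : ℂ, UHP τ → f τ = f' τ) ∧
    (∀ g : ℂ → ℂ, IsCF (k + 2) g →
      ∃ f : ℂ → ℂ, IsMFOmegaBar (k - 1) f ∧ ∀ τ : ℂ, UHP τ → f τ * xiC τ = g τ) := by
  have hw : k - 1 + 3 = k + 2 := by omega
  refine ⟨?_, ?_, ?_⟩
  · intro f hf
    refine ⟨hf.holo.mul xi_diff, aux_transf (k + 2) (fun τ => f τ * xiC τ) ?_ ?_, ?_⟩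
    · intro τ h
      simp only [hf.transT τ h, xi_T h]
      linear_combination (-(f τ * xiC τ)) * I_sq
    · intro τ h
      simp only [hf.transS τ h, xi_S h, ← hw, pow_add]
      linear_combination (-(τ ^ (k - 1) * τ ^ 3 * f τ * xiC τ)) * I_sq
    · intro ε hε
      obtain ⟨A, B, hAB⟩ := hf.bounded
      obtain ⟨B', -, hB'⟩ := xi_lim (ε / (|A| + 1)) (by positivity)
      refine ⟨max B B', fun τ hτ => ?_⟩
      have h1 := hAB τ ((le_max_left _ _).trans hτ)
      have h2 := hB' τ ((le_max_right _ _).trans hτ)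
      have h3 : ‖f τ‖ ≤ |A| + 1 := by linarith [le_abs_self A]
      rw [norm_mul]
      calc _ ≤ (|A| + 1) * (ε / (|A| + 1)) := by gcongr
        _ = ε := by field_simp
  · intro f f' _ _ h τ hτ
    exact mul_right_cancel₀ (xi_ne hτ) (h τ hτ)
  · intro g hg
    refine ⟨fun τ => g τ / xiC τ, ⟨?_, ?_, ?_, div_bounded _ g hg⟩, fun τ h => ?_⟩
    · exact hg.holo.div xi_diff fun τ h => xi_ne h
    · intro τ h
      have := hg.transf ModularGroup.T τ h
      simp [Ma, Mb, Mc, Md, ModularGroup.T] at this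
      simp only [this, xi_T h]
      have := xi_ne h
      field_simp
      linear_combination (g τ) * I_sq
    · intro τ h
      have := hg.transf ModularGroup.S τ h
      simp [Ma, Mb, Mc, Md, ModularGroup.S] at this
      simp only [neg_div, one_div] at this ⊢
      have hx := xi_S h
      simp only [neg_div, one_div] at hx
      rw [this, hx, ← hw, pow_add]
      have := xi_ne h
      have := h.ne
      field_simp
      linear_combination (g τ) * I_sq
    · exact div_mul_cancel₀ _ (xi_ne h)
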